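/- arXiv:0904.1650 — 2 statements merged into one kernel-verified Lean document; each statement's English description precedes it below -/
import Mathlib

section
/- If B is an idempotent bi-ideal (B = BB) of an AG-groupoid S with left identity, then B is a two-sided ideal of S (i.e., BS ⊆ B and SB ⊆ B). -/
open Pointwise

/-- The medial law holds in every AG-groupoid. -/
theorem medial_of_left_invertive {S : Type*} [Mul S]
    (hinv : ∀ a b c : S, (a * b) * c = (c * b) * a) (a b c d : S) :
    (a * b) * (c * d) = (a * c) * (b * d) := by
  rw [hinv a b (c * d), hinv c d b, hinv (b * d) c a]

/-- In an AG-groupoid with left identity, left multiplications commute. -/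
theorem mul_left_comm_of_left_invertive {S : Type*} [Mul S]
    (hinv : ∀ a b c : S, (a * b) * c = (c * b) * a)
    (e : S) (he : ∀ a : S, e * a = a) (a b c : S) :
    a * (b * c) = b * (a * c) := by
  simpa only [he] using medial_of_left_invertive hinv e a b c

/-- If `B` is an idempotent bi-ideal (`B = B·B`) of an AG-groupoid `S` with left
identity, then `B` is a two-sided ideal of `S`. -/
theorem idempotent_bi_ideal_is_ideal {S : Type*} [Mul S]
    (hinv : ∀ a b c : S, (a * b) * c = (c * b) * a)
    (e : S) (he : ∀ a : S, e * a = a)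
    (B : Set S) (hB1 : B * B ⊆ B) (hB2 : (B * (Set.univ : Set S)) * B ⊆ B)
    (hidem : B = B * B) :
    B * (Set.univ : Set S) ⊆ B ∧ (Set.univ : Set S) * B ⊆ B := by
  have factor : ∀ b ∈ B, ∃ c ∈ B, ∃ d ∈ B, c * d = b := fun b hb =>
    Set.mem_mul.mp (hidem ▸ hb)
  have comm := mul_left_comm_of_left_invertive hinv e he
  have right : B * (Set.univ : Set S) ⊆ B := by
    rintro _ ⟨b, hb, s, -, rfl⟩
    obtain ⟨c, hc, d, hd, rfl⟩ := factor b hb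
    obtain ⟨f, hf, g, -, rfl⟩ := factor d hd
    change c * (f * g) * s ∈ B
    rw [hinv c, comm s f g]
    exact hB2 (Set.mul_mem_mul (Set.mul_mem_mul hf (Set.mem_univ _)) hc)
  refine ⟨right, ?_⟩
  rintro _ ⟨s, -, b, hb, rfl⟩
  obtain ⟨c, hc, d, -, rfl⟩ := factor b hb
  change s * (c * d) ∈ B
  rw [comm s c d]
  exact right (Set.mul_mem_mul hc (Set.mem_univ _))
end

section
/- Let S be an AG-groupoid with left identity. Then every bi-ideal of S is idempotent (B = BB) if and only if for all bi-ideals A and B of S, A ∩ B = AB. -/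
open Pointwise

/-- A bi-ideal of an AG-groupoid `S` is a subset `B` with `B·B ⊆ B` and
`(B·S)·B ⊆ B`. -/
def IsBiIdeal {S : Type*} [Mul S] (B : Set S) : Prop :=
  B * B ⊆ B ∧ (B * (Set.univ : Set S)) * B ⊆ B

section LeftInvertive

variable {M : Type*} [Mul M]

theorem mul_mul_mul_comm_of_left_invertive
    (hinv : ∀ a b c : M, (a * b) * c = (c * b) * a) (a b c d : M) :
    (a * b) * (c * d) = (a * c) * (b * d) := by
  rw [hinv a b, hinv c d b, hinv (b * d) c a]

theorem mul_mul_mul_rev_of_left_invertive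
    (hinv : ∀ a b c : M, (a * b) * c = (c * b) * a)
    (e : M) (he : ∀ a : M, e * a = a) (a b c d : M) :
    (a * b) * (c * d) = (d * c) * (b * a) := by
  have left_comm (x y z : M) : x * (y * z) = y * (x * z) := by
    have h := mul_mul_mul_comm_of_left_invertive hinv e x y z
    rwa [he, he] at h
  rw [left_comm (a * b) c d, hinv a b d, left_comm c (d * b) a,
    mul_mul_mul_comm_of_left_invertive hinv]

theorem Set.mul_mul_eq_of_left_invertive
    (hinv : ∀ a b c : M, (a * b) * c = (c * b) * a) (A B C : Set M) :
    (A * B) * C = (C * B) * A := by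
  have sub (A B C : Set M) : (A * B) * C ⊆ (C * B) * A := by
    rintro _ ⟨_, ⟨a, ha, b, hb, rfl⟩, c, hc, rfl⟩
    exact ⟨c * b, Set.mul_mem_mul hc hb, a, ha, (hinv a b c).symm⟩
  exact (sub A B C).antisymm (sub C B A)

theorem Set.singleton_mul_of_left_identity
    (e : M) (he : ∀ a : M, e * a = a) (A : Set M) : {e} * A = A := by
  simp [Set.singleton_mul, he]

theorem Set.univ_mul_univ_of_left_identity
    (e : M) (he : ∀ a : M, e * a = a) : (Set.univ : Set M) * Set.univ = Set.univ :=
  Set.eq_univ_of_forall fun a => ⟨e, trivial, a, trivial, he a⟩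

theorem isBiIdeal_univ : IsBiIdeal (Set.univ : Set M) :=
  ⟨Set.subset_univ _, Set.subset_univ _⟩

theorem IsBiIdeal.inter {A B : Set M} (hA : IsBiIdeal A) (hB : IsBiIdeal B) :
    IsBiIdeal (A ∩ B) := by
  have hl : A ∩ B ⊆ A := Set.inter_subset_left
  have hr : A ∩ B ⊆ B := Set.inter_subset_right
  exact ⟨Set.subset_inter ((Set.mul_subset_mul hl hl).trans hA.1)
      ((Set.mul_subset_mul hr hr).trans hB.1),
    Set.subset_inter ((Set.mul_subset_mul (Set.mul_subset_mul_right hl) hl).trans hA.2)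
      ((Set.mul_subset_mul (Set.mul_subset_mul_right hr) hr).trans hB.2)⟩

theorem IsBiIdeal.mul (hinv : ∀ a b c : M, (a * b) * c = (c * b) * a)
    (e : M) (he : ∀ a : M, e * a = a) {A B : Set M}
    (hA : IsBiIdeal A) (hB : IsBiIdeal B) : IsBiIdeal (A * B) := by
  have medial := mul_mul_mul_comm_of_left_invertive (Set.mul_mul_eq_of_left_invertive hinv)
  constructor
  · rw [medial]
    exact Set.mul_subset_mul hA.1 hB.1
  · rw [← Set.univ_mul_univ_of_left_identity e he, medial A B, medial]
    exact Set.mul_subset_mul hA.2 hB.2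

/-- If all bi-ideals are idempotent, they commute with each other. -/
theorem IsBiIdeal.mul_comm (hinv : ∀ a b c : M, (a * b) * c = (c * b) * a)
    (e : M) (he : ∀ a : M, e * a = a) (idem : ∀ B : Set M, IsBiIdeal B → B = B * B)
    {A B : Set M} (hA : IsBiIdeal A) (hB : IsBiIdeal B) : A * B = B * A := by
  rw [idem _ (hA.mul hinv e he hB), idem _ (hB.mul hinv e he hA)]
  exact mul_mul_mul_rev_of_left_invertive (Set.mul_mul_eq_of_left_invertive hinv) {e}
    (Set.singleton_mul_of_left_identity e he) A B A B

/-- If all bi-ideals are idempotent, they are right ideals. -/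
theorem IsBiIdeal.mul_univ_subset (hinv : ∀ a b c : M, (a * b) * c = (c * b) * a)
    (e : M) (he : ∀ a : M, e * a = a) (idem : ∀ B : Set M, IsBiIdeal B → B = B * B)
    {A : Set M} (hA : IsBiIdeal A) : A * Set.univ ⊆ A :=
  calc A * Set.univ = (A * A) * Set.univ := by rw [← idem A hA]
    _ = (Set.univ * A) * A := Set.mul_mul_eq_of_left_invertive hinv _ _ _
    _ = (A * Set.univ) * A := by rw [hA.mul_comm hinv e he idem isBiIdeal_univ]
    _ ⊆ A := hA.2

end LeftInvertive

/-- Let `S` be an AG-groupoid with left identity. Then every bi-ideal of `S` is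
idempotent if and only if for all bi-ideals `A`, `B` of `S`, `A ∩ B = A·B`. -/
theorem every_bi_ideal_idempotent_iff_inter_eq_mul {S : Type*} [Mul S]
    (hinv : ∀ a b c : S, (a * b) * c = (c * b) * a)
    (e : S) (he : ∀ a : S, e * a = a) :
    (∀ B : Set S, IsBiIdeal B → B = B * B) ↔
      (∀ A B : Set S, IsBiIdeal A → IsBiIdeal B → A ∩ B = A * B) := by
  constructor
  · intro idem A B hA hB
    apply Set.Subset.antisymm
    · rw [idem _ (hA.inter hB)]
      exact Set.mul_subset_mul Set.inter_subset_left Set.inter_subset_right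
    · apply Set.subset_inter
      · exact (Set.mul_subset_mul_left (Set.subset_univ B)).trans
          (hA.mul_univ_subset hinv e he idem)
      · rw [hA.mul_comm hinv e he idem hB]
        exact (Set.mul_subset_mul_left (Set.subset_univ A)).trans
          (hB.mul_univ_subset hinv e he idem)
  · intro h B hB
    rw [← h B B hB hB, Set.inter_self]
end
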